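/- arXiv:1809.00047 — 2 statements merged into one kernel-verified Lean document; each statement's English description precedes it below -/
import Mathlib

section
/- For every integer n ≥ 10, δ_n < δ_{n+1}; that is, the sequence (δ_n) of largest real roots is strictly increasing. -/
/-- For an integer `n ≥ 3`, `P n` is the real polynomial function
`P_n(x) = x^(n-2) * (x^3 - x - 1) + x^3 + x^2 - 1`. -/
noncomputable def P (n : ℕ) (x : ℝ) : ℝ :=
  x ^ (n - 2) * (x ^ 3 - x - 1) + x ^ 3 + x ^ 2 - 1

lemma P_pos_of_two_le (n : ℕ) {x : ℝ} (hx : 2 ≤ x) : 0 < P n x := by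
  have h : 0 < x ^ 3 - x - 1 := by
    nlinarith [sq_nonneg x, mul_nonneg (sub_nonneg.2 hx) (sq_nonneg x)]
  have h' : 0 < x ^ (n - 2) * (x ^ 3 - x - 1) := by positivity
  unfold P
  nlinarith [sq_nonneg x]

lemma lt_of_P_neg {n : ℕ} {x d : ℝ} (hx : P n x < 0)
    (hd : IsGreatest {x : ℝ | P n x = 0} d) : x < d := by
  have hx2 : x < 2 := by
    by_contra! h
    exact absurd (P_pos_of_two_le n h) hx.not_gt
  have hc : ContinuousOn (P n) (Set.Icc x 2) := by
    unfold P
    fun_prop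
  obtain ⟨y, hy, hy0⟩ := intermediate_value_Ioo hx2.le hc ⟨hx, P_pos_of_two_le n le_rfl⟩
  exact hy.1.trans_le (hd.2 hy0)

lemma P_neg_at_eleven_tenths {n : ℕ} (hn : 10 ≤ n) : P n (11 / 10) < 0 := by
  have h : ((11 : ℝ) / 10) ^ 8 ≤ (11 / 10) ^ (n - 2) :=
    pow_le_pow_right₀ (by norm_num) (by omega)
  unfold P
  norm_num at h ⊢
  linarith

lemma P_succ_neg_of_root {n : ℕ} (hn : 2 ≤ n) {x : ℝ} (hx : 1 < x) (h : P n x = 0) :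
    P (n + 1) x < 0 := by
  unfold P at h ⊢
  have hQ : 0 < x ^ 3 + x ^ 2 - 1 := by
    linarith [one_lt_pow₀ hx three_ne_zero, sq_nonneg x]
  rw [show n + 1 - 2 = n - 2 + 1 by omega, pow_succ]
  nlinarith [mul_pos (sub_pos.2 hx) hQ]

/-- For every integer `n ≥ 10`, `δ_n < δ_{n+1}`, where `δ_m` denotes the
largest real root of `P_m`; that is, the sequence of largest real roots is strictly
increasing. -/
theorem largest_roots_strict_mono (n : ℕ) (hn : 10 ≤ n)
    (δn δn1 : ℝ)
    (hδn : IsGreatest {x : ℝ | P n x = 0} δn)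
    (hδn1 : IsGreatest {x : ℝ | P (n + 1) x = 0} δn1) :
    δn < δn1 := by
  have h1 : 1 < δn := by linarith [lt_of_P_neg (P_neg_at_eleven_tenths hn) hδn]
  exact lt_of_P_neg (P_succ_neg_of_root (by omega) h1 hδn.1) hδn1
end

section
/- The set {δ_n : n ≥ 10} ⊆ ℝ is infinite. -/
lemma continuous_P (n : ℕ) : Continuous (P n) := by
  unfold P
  fun_prop

lemma P_neg_of_eleven_le {n : ℕ} (hn : 11 ≤ n) : P n (6 / 5) < 0 := by
  have h : (6 / 5 : ℝ) ^ 9 ≤ (6 / 5) ^ (n - 2) :=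
    pow_le_pow_right₀ (by norm_num) (by omega)
  unfold P
  norm_num at h ⊢
  linarith

/-- For `n ≥ 11` the polynomial `P n` has a largest real root, and it exceeds `1`. -/
lemma exists_isGreatest_root {n : ℕ} (hn : 11 ≤ n) :
    ∃ d : ℝ, 1 < d ∧ IsGreatest {x : ℝ | P n x = 0} d := by
  obtain ⟨c, hc, hc0⟩ : (0 : ℝ) ∈ P n '' Set.Icc (6 / 5) 2 :=
    intermediate_value_Icc (by norm_num) (continuous_P n).continuousOn
      ⟨(P_neg_of_eleven_le hn).le, (P_pos_of_two_le n le_rfl).le⟩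
  have hcompact : IsCompact (Set.Icc (6 / 5 : ℝ) 2 ∩ {x | P n x = 0}) :=
    isCompact_Icc.inter_right (isClosed_eq (continuous_P n) continuous_const)
  obtain ⟨d, ⟨hd, hd0⟩, hmax⟩ := hcompact.exists_isGreatest ⟨c, hc, hc0⟩
  refine ⟨d, by linarith [hd.1], hd0, fun x (hx : P n x = 0) => ?_⟩
  by_contra! hlt
  have hx2 : x ≤ 2 := by
    by_contra! h
    exact (P_pos_of_two_le n h.le).ne' hx
  exact hlt.not_ge (hmax ⟨⟨hd.1.trans hlt.le, hx2⟩, hx⟩)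

/-- A real number greater than `1` is a root of `P n` for at most one `n ≥ 2`. -/
lemma eq_of_P_eq_zero {m n : ℕ} (hm : 2 ≤ m) (hn : 2 ≤ n) {x : ℝ} (hx : 1 < x)
    (hmx : P m x = 0) (hnx : P n x = 0) : m = n := by
  unfold P at hmx hnx
  have hpos : 0 < x ^ 3 + x ^ 2 - 1 := by
    have h2 : 1 < x ^ 2 := one_lt_pow₀ hx two_ne_zero
    have h3 : 0 < x ^ 3 := by positivity
    linarith
  have hq : x ^ 3 - x - 1 ≠ 0 := by
    intro h
    rw [h] at hmx
    linarith
  have hpow : x ^ (m - 2) = x ^ (n - 2) :=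
    mul_right_cancel₀ hq (by linarith)
  have := pow_right_injective₀ (by linarith) hx.ne' hpow
  omega

/-- The set `{δ_n : n ≥ 10} ⊆ ℝ` is infinite, where `δ_n` denotes the
largest real root of `P_n`. -/
theorem largest_roots_infinite :
    {d : ℝ | ∃ n : ℕ, 10 ≤ n ∧ IsGreatest {x : ℝ | P n x = 0} d}.Infinite := by
  choose δ hδ_one hδ using fun k : ℕ => exists_isGreatest_root (Nat.le_add_left 11 k)
  refine Set.infinite_of_injective_forall_mem (f := δ) (fun j k hjk => ?_)
    fun k => ⟨k + 11, by omega, hδ k⟩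
  have hj : P (j + 11) (δ k) = 0 := hjk ▸ (hδ j).1
  have := eq_of_P_eq_zero (by omega) (by omega) (hδ_one k) hj (hδ k).1
  omega
end
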